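/- Let n ≥ 0, r ≥ 2 and 1 ≤ t ≤ r−1 be integers. Then E_{r,t}(n) = |F_{1,r}(n)|, i.e., the excess of the number of parts congruent to t mod r in all r-regular partitions of n over the number of different part sizes appearing at least t times in all partitions of n with no part repeated more than r−1 times equals the number of partitions of n in which exactly one difference of consecutive parts (including the last part, taking the part after the last to be 0) is at least r and all other such differences are at most r−1. -/

import Mathlib

open scoped Classical

namespace BeckPaper

/-- The parts of a partition, sorted in non-increasing order. -/
def partsList {n : ℕ} (p : n.Partition) : List ℕ := p.parts.sort (· ≥ ·)

/-- The `i`-th part of a partition (`1`-indexed); `0` if `i` exceeds the number of parts. -/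
def part {n : ℕ} (p : n.Partition) (i : ℕ) : ℕ := (partsList p).getD (i - 1) 0

/-- `ℓ(λ)`: the number of parts of `λ`. -/
def numParts {n : ℕ} (p : n.Partition) : ℕ := Multiset.card p.parts

/-- `ℓ_t(λ)`: the number of parts of `λ` congruent to `t` modulo `r`. -/
def lMod (r t : ℕ) {n : ℕ} (p : n.Partition) : ℕ :=
  Multiset.card (p.parts.filter (fun x => x % r = t % r))

/-- `ℓ̄_t(λ)`: the number of different part sizes appearing at least `t` times in `λ`. -/
def lRep (t : ℕ) {n : ℕ} (p : n.Partition) : ℕ :=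
  (p.parts.toFinset.filter (fun s => t ≤ p.parts.count s)).card

/-- `ℓ̄(λ)`: the number of different part sizes of `λ`. -/
def lDist {n : ℕ} (p : n.Partition) : ℕ := p.parts.toFinset.card

/-- `d_t(λ)`: the number of indices `1 ≤ i ≤ ℓ(λ)` with `λ_i − λ_{i+1} ≥ t`. -/
def dCount (t : ℕ) {n : ℕ} (p : n.Partition) : ℕ :=
  ((Finset.Icc 1 (numParts p)).filter (fun i => t ≤ part p i - part p (i + 1))).card

/-- `λ ∈ O_r(n)`: no part is divisible by `r`. -/
def IsRegular (r : ℕ) {n : ℕ} (p : n.Partition) : Prop := ∀ x ∈ p.parts, ¬ r ∣ x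

/-- `λ ∈ D_r(n)`: no part appears more than `r − 1` times. -/
def IsRestricted (r : ℕ) {n : ℕ} (p : n.Partition) : Prop :=
  ∀ s : ℕ, p.parts.count s ≤ r - 1

/-- `λ ∈ F_r(n)`: all differences of consecutive parts (with `λ_{k+1} = 0`) are `≤ r − 1`. -/
def IsFlat (r : ℕ) {n : ℕ} (p : n.Partition) : Prop :=
  ∀ i, 1 ≤ i → i ≤ numParts p → part p i - part p (i + 1) ≤ r - 1

/-- `λ ∈ O_{1,r}(n)`: the set of part sizes divisible by `r` has exactly one element. -/
def IsOneRegular (r : ℕ) {n : ℕ} (p : n.Partition) : Prop :=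
  (p.parts.toFinset.filter (fun s => r ∣ s)).card = 1

/-- `λ ∈ D_{1,r}(n)`: exactly one part size appears at least `r` times. -/
def IsOneRestricted (r : ℕ) {n : ℕ} (p : n.Partition) : Prop :=
  (p.parts.toFinset.filter (fun s => r ≤ p.parts.count s)).card = 1

/-- `λ ∈ F_{1,r}(n)`: exactly one difference of consecutive parts is `≥ r`, and all
other such differences are `≤ r − 1`. -/
def IsOneFlat (r : ℕ) {n : ℕ} (p : n.Partition) : Prop :=
  ∃ i, (1 ≤ i ∧ i ≤ numParts p ∧ r ≤ part p i - part p (i + 1)) ∧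
    ∀ j, 1 ≤ j → j ≤ numParts p → j ≠ i → part p j - part p (j + 1) ≤ r - 1

/-- `λ ∈ T_r(n)`: exactly one part size has multiplicity at least `r`, and that
multiplicity is strictly less than `2r`. -/
def IsInT (r : ℕ) {n : ℕ} (p : n.Partition) : Prop :=
  ∃ s : ℕ, (r ≤ p.parts.count s ∧ p.parts.count s < 2 * r) ∧
    ∀ s' : ℕ, r ≤ p.parts.count s' → s' = s

/-- partitions of `m` whose multiset of parts satisfies `P` -/
noncomputable def S (m : ℕ) (P : Multiset ℕ → Prop) : Finset m.Partition :=
  Finset.univ.filter (fun p : m.Partition => P p.parts)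

theorem mem_S {m : ℕ} {P : Multiset ℕ → Prop} {p : m.Partition} : p ∈ S m P ↔ P p.parts := by
  simp [S]

theorem card_S {m : ℕ} {P : Multiset ℕ → Prop} {F : Finset m.Partition}
    (h : ∀ p, p ∈ F ↔ P p.parts) : F.card = (S m P).card := by
  congr 1
  ext p
  rw [h, mem_S]

/-- number of partitions of `m` whose multiset of parts satisfies `P` -/
noncomputable def cnt (m : ℕ) (P : Multiset ℕ → Prop) : ℕ := (S m P).card

theorem sum_sub_replicate {M : Multiset ℕ} {k s : ℕ} (h : k ≤ M.count s) :
    (M - Multiset.replicate k s).sum + s * k = M.sum := by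
  have h1 : Multiset.replicate k s ≤ M := Multiset.le_count_iff_replicate_le.mp h
  conv_rhs => rw [← Multiset.sub_add_cancel h1, Multiset.sum_add]
  simp [mul_comm]

theorem cnt_remove (n s k : ℕ) (hs : 1 ≤ s) (P : Multiset ℕ → Prop) :
    cnt n (fun M => k ≤ M.count s ∧ P (M - Multiset.replicate k s)) =
      if s * k ≤ n then cnt (n - s * k) P else 0 := by
  split_ifs with hk
  · unfold cnt
    refine Finset.card_bij'
      (fun p hp => ⟨p.parts - Multiset.replicate k s, ?_, ?_⟩)
      (fun q hq => ⟨q.parts + Multiset.replicate k s, ?_, ?_⟩) ?_ ?_ ?_ ?_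
    · intro i hi
      exact p.parts_pos (Multiset.mem_of_le (Multiset.sub_le_self _ _) hi)
    · have := sum_sub_replicate (mem_S.mp hp).1
      rw [p.parts_sum] at this
      omega
    · intro i hi
      rcases Multiset.mem_add.mp hi with h | h
      · exact q.parts_pos h
      · rw [Multiset.eq_of_mem_replicate h]; exact hs
    · rw [Multiset.sum_add, q.parts_sum]
      simp only [Multiset.sum_replicate, smul_eq_mul]
      rw [mul_comm k s]
      omega
    · intro p hp
      exact mem_S.mpr (mem_S.mp hp).2
    · intro q hq
      have := mem_S.mp hq
      rw [mem_S]
      simpa using this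
    · intro p hp
      ext1
      exact Multiset.sub_add_cancel
        (Multiset.le_count_iff_replicate_le.mp (mem_S.mp hp).1)
    · intro q hq
      ext1
      simp
  · unfold cnt
    rw [Finset.card_eq_zero, Finset.eq_empty_iff_forall_notMem]
    intro p hp
    have h1 := (mem_S.mp hp).1
    have := sum_sub_replicate h1
    rw [p.parts_sum] at this
    omega

theorem cnt_congr {n : ℕ} {P Q : Multiset ℕ → Prop}
    (h : ∀ p : n.Partition, P p.parts ↔ Q p.parts) : cnt n P = cnt n Q := by
  unfold cnt
  congr 1
  ext p
  simp only [mem_S, h p]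

def PO (r : ℕ) (M : Multiset ℕ) : Prop := ∀ x ∈ M, ¬ r ∣ x
def PD (r : ℕ) (M : Multiset ℕ) : Prop := ∀ x, M.count x ≤ r - 1
def PX (r s : ℕ) (M : Multiset ℕ) : Prop := ∀ x, x ≠ s → M.count x ≤ r - 1

theorem glaisher (n r : ℕ) (hr : 2 ≤ r) : cnt n (PO r) = cnt n (PD r) := by
  have h := Nat.Partition.card_restricted_eq_card_countRestricted n (m := r) (by omega)
  unfold Nat.Partition.restricted Nat.Partition.countRestricted at h
  unfold cnt
  refine (card_S fun p => ?_).symm.trans (h.trans (card_S fun p => ?_))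
  · simp [PO]
  · rw [Finset.mem_filter]
    simp only [Finset.mem_univ, true_and, PD]
    constructor
    · intro h i
      by_cases hi : i ∈ p.parts
      · have := h i hi
        omega
      · rw [Multiset.count_eq_zero_of_notMem hi]; omega
    · intro h i _
      have := h i
      omega

noncomputable def g (n r x : ℕ) : ℕ := if x ≤ n then cnt (n - x) (PD r) else 0

theorem cnt_O (n r m j : ℕ) (hr : 2 ≤ r) (hm : ¬ r ∣ m) :
    cnt n (fun M => PO r M ∧ j ≤ M.count m) = g n r (m * j) := by
  have hm1 : 1 ≤ m := by
    rcases Nat.eq_zero_or_pos m with h | h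
    · subst h; simp at hm
    · exact h
  unfold g
  rw [← glaisher _ _ hr, ← cnt_remove n m j hm1]
  refine cnt_congr fun p => ?_
  constructor
  · rintro ⟨h1, h2⟩
    exact ⟨h2, fun x hx => h1 x (Multiset.mem_of_le (Multiset.sub_le_self _ _) hx)⟩
  · rintro ⟨h1, h2⟩
    refine ⟨fun x hx => ?_, h1⟩
    rw [← Multiset.sub_add_cancel (Multiset.le_count_iff_replicate_le.mp h1),
      Multiset.mem_add] at hx
    rcases hx with hx | hx
    · exact h2 x hx
    · rw [Multiset.eq_of_mem_replicate hx]; exact hm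

theorem cnt_X_i (n r s k : ℕ) (hr : 2 ≤ r) (hs : 1 ≤ s) :
    cnt n (fun M => PX r s M ∧ k ≤ M.count s ∧ M.count s < k + r) = g n r (s * k) := by
  unfold g
  rw [← cnt_remove n s k hs]
  refine cnt_congr fun p => ?_
  unfold PX PD
  constructor
  · rintro ⟨h1, h2, h3⟩
    refine ⟨h2, fun x => ?_⟩
    rw [Multiset.count_sub, Multiset.count_replicate]
    split_ifs with h
    · subst h; omega
    · have := h1 x (fun h' => h h'.symm)
      omega
  · rintro ⟨h1, h2⟩
    refine ⟨fun x hx => ?_, h1, ?_⟩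
    · have := h2 x
      rw [Multiset.count_sub, Multiset.count_replicate, if_neg (fun h => hx h.symm)] at this
      omega
    · have := h2 s
      rw [Multiset.count_sub, Multiset.count_replicate, if_pos rfl] at this
      omega

theorem count_le_n {n : ℕ} (p : n.Partition) (s : ℕ) : p.parts.count s ≤ n := by
  have h1 : p.parts.card ≤ p.parts.sum := by
    have := Multiset.card_nsmul_le_sum (s := p.parts) (a := 1) (fun x hx => p.parts_pos hx)
    simpa using this
  rw [p.parts_sum] at h1
  exact (Multiset.count_le_card _ _).trans h1

theorem cnt_X (n r s t : ℕ) (hr : 2 ≤ r) (hs : 1 ≤ s) :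
    cnt n (fun M => PX r s M ∧ t ≤ M.count s) =
      ∑ i ∈ Finset.range (n + 1), g n r (s * (t + i * r)) := by
  simp_rw [← cnt_X_i n r s _ hr hs]
  unfold cnt
  rw [← Finset.card_biUnion]
  · congr 1
    ext p
    simp only [mem_S, Finset.mem_biUnion, Finset.mem_range]
    constructor
    · rintro ⟨h1, h2⟩
      refine ⟨(p.parts.count s - t) / r, ?_, h1, ?_, ?_⟩
      · have := count_le_n p s
        have := Nat.div_le_self (p.parts.count s - t) r
        omega
      · have := Nat.div_mul_le_self (p.parts.count s - t) r
        omega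
      · have := Nat.lt_div_mul_add (a := p.parts.count s - t) (b := r) (by omega)
        omega
    · rintro ⟨i, hi, h1, h2, h3⟩
      exact ⟨h1, by omega⟩
  · intro i _ j _ hij
    rw [Function.onFun, Finset.disjoint_left]
    intro p hp hq
    simp only [mem_S] at hp hq
    apply hij
    have h1 : i < j + 1 := by
      have : i * r < (j + 1) * r := by rw [add_mul]; omega
      exact lt_of_mul_lt_mul_right this (Nat.zero_le _)
    have h2 : j < i + 1 := by
      have : j * r < (i + 1) * r := by rw [add_mul]; omega
      exact lt_of_mul_lt_mul_right this (Nat.zero_le _)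
    omega

theorem cnt_X_split (n r s t : ℕ) (hr : 2 ≤ r) (ht2 : t ≤ r - 1) :
    cnt n (fun M => PX r s M ∧ t ≤ M.count s) =
      cnt n (fun M => PX r s M ∧ r ≤ M.count s) + cnt n (fun M => PD r M ∧ t ≤ M.count s) := by
  unfold cnt
  rw [← Finset.card_union_of_disjoint]
  · congr 1
    ext p
    simp only [mem_S, Finset.mem_union, PX, PD]
    constructor
    · rintro ⟨h1, h2⟩
      by_cases h : r ≤ p.parts.count s
      · exact Or.inl ⟨h1, h⟩
      · refine Or.inr ⟨fun x => ?_, h2⟩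
        by_cases hx : x = s
        · subst hx; omega
        · exact h1 x hx
    · rintro (⟨h1, h2⟩ | ⟨h1, h2⟩)
      · exact ⟨h1, by omega⟩
      · exact ⟨fun x _ => h1 x, h2⟩
  · rw [Finset.disjoint_left]
    intro p hp hq
    simp only [mem_S, PD] at hp hq
    have := hq.1 s
    omega

theorem sum_g (n r s t : ℕ) (hr : 2 ≤ r) (hs : 1 ≤ s) (ht1 : 1 ≤ t) (ht2 : t ≤ r - 1) :
    ∑ m ∈ (Finset.Icc 1 n).filter (fun m => m % r = t), g n r (m * s) =
      ∑ i ∈ Finset.range (n + 1), g n r (s * (t + i * r)) := by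
  refine Finset.sum_bij_ne_zero (fun m _ _ => m / r) ?_ ?_ ?_ ?_
  · intro m hm _
    have := Nat.div_le_self m r
    simp only [Finset.mem_filter, Finset.mem_Icc] at hm
    simp only [Finset.mem_range]
    omega
  · intro a ha _ b hb _ hab
    simp only [Finset.mem_filter, Finset.mem_Icc] at ha hb
    rw [← Nat.div_add_mod a r, ← Nat.div_add_mod b r, hab, ha.2, hb.2]
  · intro i hi hg
    have hle : s * (t + i * r) ≤ n := by
      by_contra h
      exact hg (if_neg h)
    have hle2 : t + i * r ≤ n := le_trans (Nat.le_mul_of_pos_left _ hs) hle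
    refine ⟨t + i * r, ?_, ?_, ?_⟩
    · simp only [Finset.mem_filter, Finset.mem_Icc, Nat.add_mul_mod_self_right]
      exact ⟨⟨by omega, hle2⟩, Nat.mod_eq_of_lt (by omega)⟩
    · rwa [mul_comm]
    · rw [Nat.add_mul_div_right _ _ (by omega), Nat.div_eq_of_lt (by omega), zero_add]
  · intro m hm _
    simp only [Finset.mem_filter, Finset.mem_Icc] at hm
    congr 1
    rw [mul_comm]
    congr 1
    have := Nat.div_add_mod m r
    have := hm.2
    rw [mul_comm (m / r)]
    omega

theorem sum_lMod (n r t : ℕ) (hr : 2 ≤ r) (ht1 : 1 ≤ t) (ht2 : t ≤ r - 1) :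
    ∑ p ∈ Finset.univ.filter (fun p : n.Partition => IsRegular r p), lMod r t p =
      ∑ m ∈ (Finset.Icc 1 n).filter (fun m => m % r = t), ∑ j ∈ Finset.Icc 1 n, g n r (m * j) := by
  have h1 : ∀ p : n.Partition, lMod r t p =
      ∑ m ∈ (Finset.Icc 1 n).filter (fun m => m % r = t), ∑ j ∈ Finset.Icc 1 n,
        if j ≤ p.parts.count m then 1 else 0 := by
    intro p
    have h2 : ∀ m, ∑ j ∈ Finset.Icc 1 n, (if j ≤ p.parts.count m then 1 else 0) =
        p.parts.count m := by
      intro m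
      rw [← Finset.card_filter]
      have : (Finset.Icc 1 n).filter (fun j => j ≤ p.parts.count m) =
          Finset.Icc 1 (p.parts.count m) := by
        ext j
        have := count_le_n p m
        simp only [Finset.mem_filter, Finset.mem_Icc]
        omega
      rw [this]; simp
    simp_rw [h2]
    unfold lMod
    rw [← Multiset.sum_count_eq_card (s := (Finset.Icc 1 n).filter (fun m => m % r = t))]
    · refine Finset.sum_congr rfl fun m hm => ?_
      rw [Multiset.count_filter_of_pos]
      rw [(Finset.mem_filter.mp hm).2, Nat.mod_eq_of_lt (by omega)]
    · intro a ha
      rw [Multiset.mem_filter, Nat.mod_eq_of_lt (show t < r by omega)] at ha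
      simp only [Finset.mem_filter, Finset.mem_Icc]
      exact ⟨⟨p.parts_pos ha.1, Nat.Partition.le_of_mem_parts ha.1⟩, ha.2⟩
  simp_rw [h1]
  rw [Finset.sum_comm]
  refine Finset.sum_congr rfl fun m hm => ?_
  rw [Finset.sum_comm]
  refine Finset.sum_congr rfl fun j hj => ?_
  rw [← cnt_O n r m j hr, ← Finset.card_filter, Finset.filter_filter]
  · apply card_S
    intro p
    rw [Finset.mem_filter]
    simp [PO, IsRegular]
  · intro hd
    have := Nat.mod_eq_zero_of_dvd hd
    have := (Finset.mem_filter.mp hm).2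
    omega

theorem sum_lRep (n r t : ℕ) (ht1 : 1 ≤ t) :
    ∑ p ∈ Finset.univ.filter (fun p : n.Partition => IsRestricted r p), lRep t p =
      ∑ s ∈ Finset.Icc 1 n, cnt n (fun M => PD r M ∧ t ≤ M.count s) := by
  have h1 : ∀ p : n.Partition, lRep t p =
      ∑ s ∈ Finset.Icc 1 n, if t ≤ p.parts.count s then 1 else 0 := by
    intro p
    rw [← Finset.card_filter]
    unfold lRep
    congr 1
    ext s
    simp only [Finset.mem_filter, Multiset.mem_toFinset, Finset.mem_Icc]
    constructor
    · rintro ⟨h, h'⟩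
      exact ⟨⟨p.parts_pos h, Nat.Partition.le_of_mem_parts h⟩, h'⟩
    · rintro ⟨h, h'⟩
      exact ⟨Multiset.count_pos.mp (by omega), h'⟩
  simp_rw [h1]
  rw [Finset.sum_comm]
  refine Finset.sum_congr rfl fun s hs => ?_
  rw [← Finset.card_filter, Finset.filter_filter]
  apply card_S
  intro p
  rw [Finset.mem_filter]
  simp [PD, IsRestricted]

/-- exactly one part with multiplicity at least `r` -/
def PD1 (r : ℕ) (M : Multiset ℕ) : Prop := ∃ s, PX r s M ∧ r ≤ M.count s

theorem sum_X (n r : ℕ) (hr : 2 ≤ r) :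
    ∑ s ∈ Finset.Icc 1 n, cnt n (fun M => PX r s M ∧ r ≤ M.count s) = cnt n (PD1 r) := by
  unfold cnt
  rw [← Finset.card_biUnion]
  · congr 1
    ext p
    simp only [mem_S, Finset.mem_biUnion, Finset.mem_Icc,
      PD1]
    constructor
    · rintro ⟨s, _, h⟩
      exact ⟨s, h⟩
    · rintro ⟨s, h⟩
      have hs : s ∈ p.parts := Multiset.count_pos.mp (by omega)
      exact ⟨s, ⟨p.parts_pos hs, Nat.Partition.le_of_mem_parts hs⟩, h⟩
  · intro i _ j _ hij
    rw [Function.onFun, Finset.disjoint_left]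
    intro p hp hq
    simp only [mem_S, PX] at hp hq
    have := hp.1 j (Ne.symm hij)
    omega

theorem part_eq_zero {n : ℕ} (p : n.Partition) {i : ℕ} (h : numParts p < i) : part p i = 0 := by
  unfold part
  apply List.getD_eq_default
  simp only [partsList, Multiset.length_sort]
  unfold numParts at h
  omega

theorem part_pos {n : ℕ} (p : n.Partition) {i : ℕ} (h1 : 1 ≤ i) (h : i ≤ numParts p) :
    0 < part p i := by
  unfold part
  have hl : i - 1 < (partsList p).length := by
    simp only [partsList, Multiset.length_sort]
    unfold numParts at h
    omega
  rw [List.getD_eq_getElem _ _ hl]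
  apply p.parts_pos
  rw [← Multiset.mem_sort (r := (· ≥ ·))]
  exact List.getElem_mem hl

theorem part_anti {n : ℕ} (p : n.Partition) {i : ℕ} (h1 : 1 ≤ i) :
    part p (i + 1) ≤ part p i := by
  by_cases h : i + 1 ≤ numParts p
  · unfold part
    have hl : i + 1 - 1 < (partsList p).length := by
      simp only [partsList, Multiset.length_sort]
      unfold numParts at h
      omega
    rw [List.getD_eq_getElem _ _ hl, List.getD_eq_getElem _ _ (by omega)]
    have hs : (partsList p).Pairwise (· ≥ ·) := Multiset.pairwise_sort _ _
    exact List.pairwise_iff_getElem.mp hs (i - 1) (i + 1 - 1) (by omega) hl (by omega)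
  · rw [part_eq_zero p (by omega)]; exact Nat.zero_le _

theorem sum_part {n : ℕ} (p : n.Partition) :
    ∑ i ∈ Finset.range (numParts p), part p (i + 1) = n := by
  have h : (partsList p).sum = n := by
    rw [← Multiset.sum_coe]
    unfold partsList
    rw [Multiset.sort_eq, p.parts_sum]
  refine Eq.trans ?_ h
  have hl : numParts p = (partsList p).length := by simp [numParts, partsList]
  rw [hl, Finset.sum_range, ← List.sum_ofFn]
  congr 1
  apply List.ext_getElem
  · simp
  · intro i h1 h2
    simp [part, h2]

theorem abel (f : ℕ → ℕ) (hf : ∀ i, f (i + 1) ≤ f i) (k : ℕ) :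
    ∑ i ∈ Finset.range k, (i + 1) * (f i - f (i + 1)) + k * f k = ∑ i ∈ Finset.range k, f i := by
  induction k with
  | zero => simp
  | succ k ih =>
    rw [Finset.sum_range_succ, Finset.sum_range_succ, ← ih]
    obtain ⟨d, hd⟩ := Nat.exists_eq_add_of_le (hf k)
    rw [hd, Nat.add_sub_cancel_left]
    ring

noncomputable def conjParts {n : ℕ} (p : n.Partition) : Multiset ℕ :=
  ∑ i ∈ Finset.range (numParts p),
    Multiset.replicate (part p (i + 1) - part p (i + 1 + 1)) (i + 1)

noncomputable def conj {n : ℕ} (p : n.Partition) : n.Partition where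
  parts := conjParts p
  parts_pos := by
    intro x hx
    unfold conjParts at hx
    rw [Multiset.mem_sum] at hx
    obtain ⟨i, _, hi⟩ := hx
    rw [Multiset.eq_of_mem_replicate hi]
    exact Nat.succ_pos i
  parts_sum := by
    unfold conjParts
    rw [← Multiset.coe_sumAddMonoidHom, map_sum]
    simp only [Multiset.coe_sumAddMonoidHom, Multiset.sum_replicate, smul_eq_mul]
    have := abel (fun i => part p (i + 1)) (fun i => part_anti p (by omega)) (numParts p)
    rw [part_eq_zero p (Nat.lt_succ_self _), sum_part] at this
    simp only [mul_zero, add_zero] at this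
    conv_rhs => rw [← this]
    exact Finset.sum_congr rfl fun i _ => mul_comm _ _

theorem count_conj {n : ℕ} (p : n.Partition) (i : ℕ) (hi : 1 ≤ i) :
    (conj p).parts.count i = part p i - part p (i + 1) := by
  change (conjParts p).count i = _
  unfold conjParts
  rw [Multiset.count_sum']
  simp only [Multiset.count_replicate]
  obtain ⟨j, rfl⟩ := Nat.exists_eq_add_of_le' hi
  by_cases hj : j < numParts p
  · rw [Finset.sum_eq_single j]
    · simp
    · intro b _ hb
      rw [if_neg (by omega)]
    · intro h
      exact absurd (Finset.mem_range.mpr hj) h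
  · rw [part_eq_zero p (show numParts p < j + 1 by omega)]
    rw [Finset.sum_eq_zero]
    · simp
    · intro b hb
      have := Finset.mem_range.mp hb
      rw [if_neg (by omega)]

theorem conj_injective (n : ℕ) : Function.Injective (conj (n := n)) := by
  intro p q h
  have hd : ∀ i, 1 ≤ i → part p i - part p (i + 1) = part q i - part q (i + 1) := by
    intro i hi
    rw [← count_conj p i hi, ← count_conj q i hi, h]
  have hpart : ∀ d i, 1 ≤ i → numParts p + numParts q + 1 ≤ i + d → part p i = part q i := by
    intro d
    induction d with
    | zero =>
      intro i _ h2
      rw [part_eq_zero p (by omega), part_eq_zero q (by omega)]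
    | succ d ih =>
      intro i h1 h2
      have e1 := ih (i + 1) (by omega) (by omega)
      have e2 := hd i h1
      have e3 := part_anti p h1
      have e4 := part_anti q h1
      omega
  have hall : ∀ i, 1 ≤ i → part p i = part q i := fun i hi => hpart _ i hi (Nat.le_add_left _ _)
  have hnum : numParts p = numParts q := by
    rcases lt_trichotomy (numParts p) (numParts q) with h | h | h
    · have a := part_pos q (show 1 ≤ numParts q by omega) le_rfl
      rw [← hall _ (by omega), part_eq_zero p h] at a
      omega
    · exact h
    · have a := part_pos p (show 1 ≤ numParts p by omega) le_rfl
      rw [hall _ (by omega), part_eq_zero q h] at a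
      omega
  have hlist : partsList p = partsList q := by
    apply List.ext_getElem
    · simpa [numParts, partsList] using hnum
    · intro i h1 h2
      have := hall (i + 1) (by omega)
      unfold part at this
      rwa [Nat.add_sub_cancel, List.getD_eq_getElem _ _ h1, List.getD_eq_getElem _ _ h2] at this
  ext1
  rw [← Multiset.sort_eq p.parts (· ≥ ·), ← Multiset.sort_eq q.parts (· ≥ ·)]
  exact congrArg _ hlist

theorem oneFlat_iff (n r : ℕ) (hr : 2 ≤ r) (p : n.Partition) :
    IsOneFlat r p ↔ PD1 r (conj p).parts := by
  unfold IsOneFlat PD1 PX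
  constructor
  · rintro ⟨i, ⟨h1, h2, h3⟩, h4⟩
    refine ⟨i, fun x hx => ?_, by rwa [count_conj p i h1]⟩
    by_cases hx0 : 1 ≤ x
    · rw [count_conj p x hx0]
      by_cases hxn : x ≤ numParts p
      · exact h4 x hx0 hxn hx
      · rw [part_eq_zero p (by omega)]; omega
    · rw [Multiset.count_eq_zero_of_notMem]
      · omega
      · intro hm
        exact hx0 ((conj p).parts_pos hm)
  · rintro ⟨i, h1, h2⟩
    have hi : 1 ≤ i := (conj p).parts_pos (Multiset.count_pos.mp (by omega))
    rw [count_conj p i hi] at h2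
    refine ⟨i, ⟨hi, ?_, h2⟩, fun j hj _ hji => ?_⟩
    · by_contra h
      rw [part_eq_zero p (by omega)] at h2
      omega
    · rw [← count_conj p j hj]
      exact h1 j hji

theorem card_oneFlat (n r : ℕ) (hr : 2 ≤ r) :
    (Finset.univ.filter (fun p : n.Partition => IsOneFlat r p)).card = cnt n (PD1 r) := by
  unfold cnt
  have hb : Function.Bijective (conj (n := n)) := (conj_injective n).bijective_of_finite
  refine Finset.card_bijective conj hb fun p => ?_
  simp [oneFlat_iff n r hr p, mem_S]

theorem excess_eq_oneFlat (n r t : ℕ) (hr : 2 ≤ r) (ht1 : 1 ≤ t) (ht2 : t ≤ r - 1) :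
    ((∑ p ∈ Finset.univ.filter (fun p : n.Partition => IsRegular r p), (lMod r t p : ℤ)) -
      ∑ p ∈ Finset.univ.filter (fun p : n.Partition => IsRestricted r p), (lRep t p : ℤ)) =
      ((Finset.univ.filter (fun p : n.Partition => IsOneFlat r p)).card : ℤ) := by
  rw [card_oneFlat n r hr, ← sum_X n r hr, ← Nat.cast_sum, ← Nat.cast_sum,
    sum_lMod n r t hr ht1 ht2, sum_lRep n r t ht1, sub_eq_iff_eq_add, ← Nat.cast_add,
    ← Finset.sum_add_distrib, Finset.sum_comm]
  congr 1
  refine Finset.sum_congr rfl fun s hs => ?_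
  have hs1 := (Finset.mem_Icc.mp hs).1
  rw [sum_g n r s t hr hs1 ht1 ht2, ← cnt_X n r s t hr hs1, cnt_X_split n r s t hr ht2]

end BeckPaper
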